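/- The concept language L(≥,⊓,⊤) admits finite characterisations of doubly exponential size: for all finite signatures Σ_C, Σ_R, every concept C ∈ L(≥,⊓,⊤)[Σ_C,Σ_R] has a finite characterisation (E⁺,E⁻) w.r.t. L(≥,⊓,⊤)[Σ_C,Σ_R] in which every example (I,d) satisfies |Δ^I| ≤ N^N, where N = 5 · (dp(C)+1) · |C|³ + |C|, and the number of negative examples is at most N. -/

import Mathlib

namespace DL

/-! ### Syntax of ALCQI concepts -/

/-- Roles: role names (indexed by ℕ) and inverse roles. -/
inductive Role where
  | name : ℕ → Role
  | inv  : ℕ → Role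
deriving DecidableEq

/-- ALCQI concept expressions. -/
inductive Concept where
  | atom : ℕ → Concept
  | top  : Concept
  | bot  : Concept
  | and  : Concept → Concept → Concept
  | or   : Concept → Concept → Concept
  | neg  : Concept → Concept
  | ex   : Role → Concept → Concept
  | all  : Role → Concept → Concept
  | atLeast : ℕ → Role → Concept → Concept
deriving DecidableEq

/-- The operators/constructors that a concept language may use. -/
inductive Op where
  | all | ex | ge | inv | and | or | top | bot | neg
deriving DecidableEq

/-! ### Interpretations and semantics -/

/-- An interpretation: a nonempty domain, interpretations of concept names
and of role names. -/
structure Interp where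
  Δ : Type
  dom_nonempty : Nonempty Δ
  atom : ℕ → Set Δ
  rel : ℕ → Δ → Δ → Prop

def Role.sem (I : Interp) : Role → (I.Δ → I.Δ → Prop)
  | .name R => I.rel R
  | .inv R  => fun d e => I.rel R e d

def Concept.sem (I : Interp) : Concept → Set I.Δ
  | .atom A => I.atom A
  | .top => Set.univ
  | .bot => ∅
  | .and C D => C.sem I ∩ D.sem I
  | .or C D => C.sem I ∪ D.sem I
  | .neg C => (C.sem I)ᶜ
  | .ex S C => {d | ∃ e, S.sem I d e ∧ e ∈ C.sem I}
  | .all S C => {d | ∀ e, S.sem I d e → e ∈ C.sem I}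
  | .atLeast k S C => {d | ∃ s : Finset I.Δ, s.card = k ∧ ∀ e ∈ s, S.sem I d e ∧ e ∈ C.sem I}

/-! ### Concept languages L(Os)[SC, SR] -/

def Role.inSig (Os : Finset Op) (SR : Finset ℕ) : Role → Prop
  | .name R => R ∈ SR
  | .inv R  => Op.inv ∈ Os ∧ R ∈ SR

/-- Membership of a concept in the language `L(Os)[SC, SR]`. -/
def Concept.inLang (Os : Finset Op) (SC SR : Finset ℕ) : Concept → Prop
  | .atom A => A ∈ SC
  | .top => Op.top ∈ Os
  | .bot => Op.bot ∈ Os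
  | .and C D => Op.and ∈ Os ∧ C.inLang Os SC SR ∧ D.inLang Os SC SR
  | .or C D => Op.or ∈ Os ∧ C.inLang Os SC SR ∧ D.inLang Os SC SR
  | .neg C => Op.neg ∈ Os ∧ C.inLang Os SC SR
  | .ex S C => Op.ex ∈ Os ∧ S.inSig Os SR ∧ C.inLang Os SC SR
  | .all S C => Op.all ∈ Os ∧ S.inSig Os SR ∧ C.inLang Os SC SR
  | .atLeast k S C => Op.ge ∈ Os ∧ 1 ≤ k ∧ S.inSig Os SR ∧ C.inLang Os SC SR

/-! ### DL-Lite ontologies -/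

/-- Basic concepts: concept names, ∃R and ∃R⁻. -/
inductive Basic where
  | atom : ℕ → Basic
  | ex : Role → Basic
deriving DecidableEq

def Basic.sem (I : Interp) : Basic → Set I.Δ
  | .atom A => I.atom A
  | .ex S => {d | ∃ e, S.sem I d e}

/-- A DL-Lite concept inclusion `B ⊑ C` where `C` is a basic concept
(`negated = false`) or a negated basic concept (`negated = true`). -/
structure CI where
  lhs : Basic
  rhs : Basic
  negated : Bool
deriving DecidableEq

def CI.sat (I : Interp) (ci : CI) : Prop :=
  if ci.negated then ci.lhs.sem I ⊆ (ci.rhs.sem I)ᶜ else ci.lhs.sem I ⊆ ci.rhs.sem I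

/-- A DL-Lite ontology: a finite set (list) of concept inclusions. -/
abbrev Ontology := List CI

def Interp.satO (I : Interp) (Ont : Ontology) : Prop := ∀ ci ∈ Ont, ci.sat I

/-! ### Pointed interpretations, examples, characterisations -/

structure PInterp where
  I : Interp
  pt : I.Δ

/-- A pointed interpretation is finite if its domain is finite. -/
def PInterp.finite (P : PInterp) : Prop := Finite P.I.Δ

/-- `C` fits a collection `(Epos, Eneg)` of labelled examples. -/
def Fits (C : Concept) (Epos Eneg : List PInterp) : Prop :=
  (∀ e ∈ Epos, e.pt ∈ C.sem e.I) ∧ (∀ e ∈ Eneg, e.pt ∉ C.sem e.I)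

/-- Equivalence of concepts. -/
def CEquiv (C D : Concept) : Prop := ∀ I : Interp, C.sem I = D.sem I

/-- Equivalence of concepts relative to an ontology. -/
def CEquivO (Ont : Ontology) (C D : Concept) : Prop :=
  ∀ I : Interp, I.satO Ont → C.sem I = D.sem I

/-- `⊨ C ⊑ D`. -/
def Subsumes (C D : Concept) : Prop := ∀ I : Interp, C.sem I ⊆ D.sem I

/-- `Ont ⊨ C ⊑ D`. -/
def SubsumesO (Ont : Ontology) (C D : Concept) : Prop :=
  ∀ I : Interp, I.satO Ont → C.sem I ⊆ D.sem I

/-- `(Epos, Eneg)` is a finite characterisation of `C` w.r.t. the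
concept language (predicate) `L`: all examples are finite, `C` fits,
and every fitting concept of `L` is equivalent to `C`. -/
def FinChar (L : Concept → Prop) (C : Concept) (Epos Eneg : List PInterp) : Prop :=
  (∀ e ∈ Epos ++ Eneg, e.finite) ∧
  Fits C Epos Eneg ∧
  ∀ D, L D → Fits D Epos Eneg → CEquiv C D

/-- Finite characterisation of `C` w.r.t. `L` under an ontology `Ont`:
all examples are finite and satisfy `Ont`, `C` fits, and every fitting
concept of `L` is equivalent to `C` relative to `Ont`. -/
def FinCharO (Ont : Ontology) (L : Concept → Prop) (C : Concept)
    (Epos Eneg : List PInterp) : Prop :=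
  (∀ e ∈ Epos ++ Eneg, e.finite ∧ e.I.satO Ont) ∧
  Fits C Epos Eneg ∧
  ∀ D, L D → Fits D Epos Eneg → CEquivO Ont C D

/-- `L(Os)` admits finite characterisations. -/
def AdmitsFinChar (Os : Finset Op) : Prop :=
  ∀ SC SR : Finset ℕ, ∀ C : Concept, C.inLang Os SC SR →
    ∃ Epos Eneg : List PInterp, FinChar (Concept.inLang Os SC SR) C Epos Eneg

/-- `L(Os)` admits finite characterisations under the ontology `Ont`. -/
def AdmitsFinCharO (Os : Finset Op) (Ont : Ontology) : Prop :=
  ∀ SC SR : Finset ℕ, ∀ C : Concept, C.inLang Os SC SR →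
    ∃ Epos Eneg : List PInterp, FinCharO Ont (Concept.inLang Os SC SR) C Epos Eneg

/-! ### Size, role depth, number restrictions -/

/-- Number of symbols of a concept expression (numbers in binary). -/
def Concept.size : Concept → ℕ
  | .atom _ => 1
  | .top => 1
  | .bot => 1
  | .and C D => C.size + D.size + 1
  | .or C D => C.size + D.size + 1
  | .neg C => C.size + 1
  | .ex _ C => C.size + 2
  | .all _ C => C.size + 2
  | .atLeast k _ C => C.size + 2 + Nat.size k

/-- Role depth of a concept. -/
def Concept.dp : Concept → ℕ
  | .atom _ => 0
  | .top => 0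
  | .bot => 0
  | .and C D => max C.dp D.dp
  | .or C D => max C.dp D.dp
  | .neg C => C.dp
  | .ex _ C => C.dp + 1
  | .all _ C => C.dp + 1
  | .atLeast _ _ C => C.dp + 1

/-- The largest number occurring in a number restriction of `C` (0 if none). -/
def Concept.nr : Concept → ℕ
  | .atom _ => 0
  | .top => 0
  | .bot => 0
  | .and C D => max C.nr D.nr
  | .or C D => max C.nr D.nr
  | .neg C => C.nr
  | .ex _ C => C.nr
  | .all _ C => C.nr
  | .atLeast k _ C => max k C.nr

/-- The operator set of `L(≥,⊓,⊤)`. -/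
def ELQops : Finset Op := {Op.ge, Op.and, Op.top}

/-! ### The fragment with number restrictions, conjunction and top -/

/-- The concepts of `L(≥,⊓,⊤)[SC,SR]`, as an inductive predicate. -/
inductive IsELQ (SC SR : Finset ℕ) : Concept → Prop
  | atom {A : ℕ} (hA : A ∈ SC) : IsELQ SC SR (.atom A)
  | top : IsELQ SC SR .top
  | and {C D : Concept} (hC : IsELQ SC SR C) (hD : IsELQ SC SR D) : IsELQ SC SR (.and C D)
  | atLeast {k R : ℕ} {C : Concept} (hk : 1 ≤ k) (hR : R ∈ SR) (hC : IsELQ SC SR C) :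
      IsELQ SC SR (.atLeast k (.name R) C)

theorem IsELQ.of_inLang {SC SR : Finset ℕ} {C : Concept} (h : C.inLang ELQops SC SR) :
    IsELQ SC SR C := by
  induction C with
  | atom A => exact .atom h
  | top => exact .top
  | and C D ihC ihD => exact .and (ihC h.2.1) (ihD h.2.2)
  | atLeast k S C ih =>
    obtain ⟨-, hk, hS, hC⟩ := h
    cases S with
    | name R => exact .atLeast hk hS (ih hC)
    | inv R => exact absurd hS.1 (by decide)
  | bot => exact absurd h (by unfold Concept.inLang; decide)
  | or C D => exact absurd h.1 (by decide)
  | neg C => exact absurd h.1 (by decide)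
  | ex S C => exact absurd h.1 (by decide)
  | all S C => exact absurd h.1 (by decide)

theorem Concept.one_le_size (C : Concept) : 1 ≤ C.size := by
  cases C <;> simp only [Concept.size] <;> omega

theorem IsELQ.nr_le_two_pow_size {SC SR : Finset ℕ} {C : Concept} (h : IsELQ SC SR C) :
    C.nr ≤ 2 ^ C.size := by
  induction h with
  | atom | top => simp [Concept.nr]
  | @and C D _ _ ihC ihD =>
    have h₁ : 2 ^ C.size ≤ 2 ^ (C.size + D.size + 1) :=
      Nat.pow_le_pow_right (by norm_num) (by omega)
    have h₂ : 2 ^ D.size ≤ 2 ^ (C.size + D.size + 1) :=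
      Nat.pow_le_pow_right (by norm_num) (by omega)
    exact max_le (ihC.trans h₁) (ihD.trans h₂)
  | @atLeast k R C _ _ _ ih =>
    have h₁ : 2 ^ C.size ≤ 2 ^ (C.size + 2 + Nat.size k) :=
      Nat.pow_le_pow_right (by norm_num) (by omega)
    have h₂ : 2 ^ Nat.size k ≤ 2 ^ (C.size + 2 + Nat.size k) :=
      Nat.pow_le_pow_right (by norm_num) (by omega)
    exact max_le ((Nat.lt_size_self k).le.trans h₂) (ih.trans h₁)

/-- A concept satisfied in a finite interpretation only uses numbers up to the domain size. -/
theorem IsELQ.nr_le_card {SC SR : Finset ℕ} {D : Concept} (h : IsELQ SC SR D) (I : Interp)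
    [Finite I.Δ] {d : I.Δ} (hd : d ∈ D.sem I) : D.nr ≤ Nat.card I.Δ := by
  induction h generalizing d with
  | atom | top => simp [Concept.nr]
  | and _ _ ihC ihD => exact max_le (ihC hd.1) (ihD hd.2)
  | atLeast hk _ _ ih =>
    obtain ⟨s, rfl, hs⟩ := hd
    obtain ⟨e, he⟩ := Finset.card_pos.mp hk
    have := Fintype.ofFinite I.Δ
    refine max_le ?_ (ih (hs e he).2)
    rw [Nat.card_eq_fintype_card]
    exact s.card_le_univ

/-! ### Small models -/

/-- The interpretation on `Fin m` with given extensions of the names in a finite signature;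
all other names are empty. -/
def finInterp (SC SR : Finset ℕ) {m : ℕ} (p : Fin m) (a : SC → Set (Fin m))
    (r : SR → Fin m → Fin m → Prop) : Interp where
  Δ := Fin m
  dom_nonempty := ⟨p⟩
  atom A := {x | ∃ h : A ∈ SC, x ∈ a ⟨A, h⟩}
  rel R x y := ∃ h : R ∈ SR, r ⟨R, h⟩ x y

/-- The pullback of an interpretation along `g : Fin m → Δ`, restricted to a signature. -/
def Interp.pullback (I : Interp) (SC SR : Finset ℕ) {m : ℕ} (p : Fin m) (g : Fin m → I.Δ) :
    Interp :=
  finInterp SC SR p (fun A => g ⁻¹' I.atom A) (fun R x y => I.rel R (g x) (g y))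

theorem IsELQ.sem_of_sem_pullback {SC SR : Finset ℕ} {D : Concept} (h : IsELQ SC SR D)
    (I : Interp) {m : ℕ} (p : Fin m) {g : Fin m → I.Δ} (hg : Function.Injective g) {x : Fin m}
    (hx : x ∈ D.sem (I.pullback SC SR p g)) : g x ∈ D.sem I := by
  induction h generalizing x with
  | atom hA => exact hx.2
  | top => trivial
  | and _ _ ihC ihD => exact ⟨ihC hx.1, ihD hx.2⟩
  | atLeast hk hR _ ih =>
    obtain ⟨s, hs, hs'⟩ := hx
    refine ⟨Finset.map ⟨g, hg⟩ s, (Finset.card_map _).trans hs, ?_⟩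
    intro e he
    obtain ⟨y, hy, rfl⟩ := Finset.mem_map.mp he
    exact ⟨(hs' y hy).1.2, ih (hs' y hy).2⟩

/-- Satisfaction of a concept only depends on at most `2 ^ |C|` elements. -/
theorem IsELQ.exists_small_support {SC SR : Finset ℕ} {C : Concept} (h : IsELQ SC SR C)
    (I : Interp) {d : I.Δ} (hd : d ∈ C.sem I) :
    ∃ S : Finset I.Δ, d ∈ S ∧ S.card ≤ 2 ^ C.size ∧
      ∀ (m : ℕ) (p : Fin m) (g : Fin m → I.Δ), Function.Injective g → ↑S ⊆ Set.range g →
        ∀ x, g x = d → x ∈ C.sem (I.pullback SC SR p g) := by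
  classical
  induction h generalizing d with
  | atom hA =>
    refine ⟨{d}, by simp, by simp [Concept.size], ?_⟩
    rintro m p g - - x rfl
    exact ⟨hA, hd⟩
  | top => exact ⟨{d}, by simp, by simp [Concept.size], fun _ _ _ _ _ _ _ => trivial⟩
  | @and C D _ _ ihC ihD =>
    obtain ⟨S, hdS, hS, hS'⟩ := ihC hd.1
    obtain ⟨T, hdT, hT, hT'⟩ := ihD hd.2
    refine ⟨S ∪ T, by simp [hdS], ?_, ?_⟩
    · have h₁ : 2 ^ C.size ≤ 2 ^ (C.size + D.size) :=
        Nat.pow_le_pow_right (by norm_num) (by omega)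
      have h₂ : 2 ^ D.size ≤ 2 ^ (C.size + D.size) :=
        Nat.pow_le_pow_right (by norm_num) (by omega)
      have := Finset.card_union_le S T
      rw [Concept.size, pow_succ]
      omega
    · intro m p g hg hr x hx
      rw [Finset.coe_union, Set.union_subset_iff] at hr
      exact ⟨hS' m p g hg hr.1 x hx, hT' m p g hg hr.2 x hx⟩
  | @atLeast k R C hk hR _ ih =>
    obtain ⟨s, hs, hs'⟩ := hd
    choose! S hmem hcard hsat using fun e (he : e ∈ s) => ih (hs' e he).2
    refine ⟨insert d (s.biUnion S), by simp, ?_, ?_⟩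
    · have h₁ : (s.biUnion S).card ≤ k * 2 ^ C.size := by
        rw [← hs]
        exact Finset.card_biUnion_le_card_mul _ _ _ hcard
      have h₂ := Finset.card_insert_le d (s.biUnion S)
      have h₃ : (k + 1) * 2 ^ C.size ≤ 2 ^ Nat.size k * 2 ^ C.size :=
        Nat.mul_le_mul_right _ (Nat.lt_size_self k)
      have h₄ : 2 ^ Nat.size k * 2 ^ C.size ≤ 2 ^ (C.size + 2 + Nat.size k) := by
        rw [← pow_add]
        exact Nat.pow_le_pow_right (by norm_num) (by omega)
      have h₅ : 1 ≤ 2 ^ C.size := Nat.one_le_two_pow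
      rw [Concept.size]
      linarith
    · rintro m p g hg hr x rfl
      have hsr : ∀ e ∈ s, S e ⊆ insert (g x) (s.biUnion S) := fun e he =>
        (Finset.subset_biUnion_of_mem S he).trans (Finset.subset_insert _ _)
      have hrange : (s : Set I.Δ) ⊆ Set.range g := fun e he => hr (hsr e he (hmem e he))
      have hpre : (s.preimage g hg.injOn).card = s.card := by
        rw [Finset.card_preimage, Finset.filter_true_of_mem hrange]
      refine ⟨s.preimage g hg.injOn, hpre.trans hs, ?_⟩
      intro y hy
      have hy' : g y ∈ s := Finset.mem_preimage.mp hy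
      exact ⟨⟨hR, (hs' _ hy').1⟩, hsat _ hy' m p g hg
        ((Finset.coe_subset.mpr (hsr _ hy')).trans hr) y rfl⟩

/-- Up to isomorphism and names outside the signature, there are only finitely many pointed
models of `C` of size at most `M`. -/
theorem exists_list_small_models (SC SR : Finset ℕ) (C : Concept) (M : ℕ) :
    ∃ L : List PInterp, (∀ e ∈ L, e.finite ∧ Nat.card e.I.Δ ≤ M ∧ e.pt ∈ C.sem e.I) ∧
      ∀ (m : ℕ) (p : Fin m) (a : SC → Set (Fin m)) (r : SR → Fin m → Fin m → Prop), m ≤ M →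
        p ∈ C.sem (finInterp SC SR p a r) → ⟨finInterp SC SR p a r, p⟩ ∈ L := by
  classical
  let X := Σ m : Fin (M + 1), Fin m × (SC → Set (Fin m)) × (SR → Fin m → Fin m → Prop)
  let f : X → PInterp := fun x => ⟨finInterp SC SR x.2.1 x.2.2.1 x.2.2.2, x.2.1⟩
  have : Fintype X := Fintype.ofFinite X
  refine ⟨((Finset.univ : Finset X).toList.map f).filter (fun e => e.pt ∈ C.sem e.I), ?_, ?_⟩
  · intro e he
    simp only [List.mem_filter, List.mem_map, Finset.mem_toList, Finset.mem_univ, true_and,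
      decide_eq_true_eq] at he
    obtain ⟨⟨x, rfl⟩, hx⟩ := he
    refine ⟨inferInstanceAs (Finite (Fin x.1)), ?_, hx⟩
    change Nat.card (Fin x.1) ≤ M
    rw [Nat.card_fin]
    omega
  · intro m p a r hm hp
    simp only [List.mem_filter, List.mem_map, Finset.mem_toList, Finset.mem_univ, true_and,
      decide_eq_true_eq]
    exact ⟨⟨⟨⟨m, by omega⟩, p, a, r⟩, rfl⟩, hp⟩

/-- Every pointed model of `C` has a small submodel. -/
theorem IsELQ.exists_small_pullback {SC SR : Finset ℕ} {C : Concept} (h : IsELQ SC SR C)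
    (I : Interp) {d : I.Δ} (hd : d ∈ C.sem I) :
    ∃ (m : ℕ) (p : Fin m) (g : Fin m → I.Δ), m ≤ 2 ^ C.size ∧ Function.Injective g ∧ g p = d ∧
      p ∈ C.sem (I.pullback SC SR p g) := by
  obtain ⟨S, hdS, hS, hS'⟩ := h.exists_small_support I hd
  have hinj : Function.Injective fun i => (S.equivFin.symm i : I.Δ) :=
    Subtype.val_injective.comp S.equivFin.symm.injective
  refine ⟨S.card, S.equivFin ⟨d, hdS⟩, fun i => (S.equivFin.symm i : I.Δ), hS, hinj, by simp, ?_⟩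
  refine hS' _ _ _ hinj ?_ _ (by simp)
  exact fun e he => ⟨S.equivFin ⟨e, he⟩, by simp⟩

/-! ### The falsifying interpretation -/

/-- The conjuncts of a concept. -/
def Concept.conjuncts : Concept → Finset Concept
  | .atom A => {.atom A}
  | .and C D => C.conjuncts ∪ D.conjuncts
  | .atLeast k R C => {.atLeast k R C}
  | _ => ∅

/-- The conjuncts of a concept and, recursively, of the concepts below its number restrictions. -/
def Concept.nestedConjuncts : Concept → Finset Concept
  | .atom A => {.atom A}
  | .and C D => C.nestedConjuncts ∪ D.nestedConjuncts
  | .atLeast k R C => insert (.atLeast k R C) C.nestedConjuncts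
  | _ => ∅

theorem Concept.conjuncts_subset (C : Concept) : C.conjuncts ⊆ C.nestedConjuncts := by
  induction C with
  | and C D ihC ihD => exact Finset.union_subset_union ihC ihD
  | _ => simp [Concept.conjuncts, Concept.nestedConjuncts]

theorem Concept.card_nestedConjuncts_le (C : Concept) : C.nestedConjuncts.card ≤ C.size := by
  induction C with
  | and C D ihC ihD =>
    have := Finset.card_union_le C.nestedConjuncts D.nestedConjuncts
    simp only [Concept.nestedConjuncts, Concept.size]
    omega
  | atLeast k R C ih =>
    have := Finset.card_insert_le (.atLeast k R C) C.nestedConjuncts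
    simp only [Concept.nestedConjuncts, Concept.size]
    omega
  | _ => simp [Concept.nestedConjuncts, Concept.size]

/-- Admissible `R`-edges leaving the elements `(x, _)` of the falsifying interpretation. -/
def falsifierRel (R : ℕ) (x y : Option Concept) (j : ℕ) : Prop :=
  ∀ k F, x = some (.atLeast k (.name R) F) →
    match y with
    | none => j + 1 < k
    | some G => G ∈ F.conjuncts

/-- An interpretation consisting of `K` copies of a saturated element `none` and of an element
`some G` for every `G ∈ S`, which falsifies `G` but is otherwise as saturated as possible. -/
def falsifier (S : Finset Concept) (K : ℕ) (hK : 0 < K) : Interp where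
  Δ := Option S × Fin K
  dom_nonempty := ⟨(none, ⟨0, hK⟩)⟩
  atom A := {x | x.1.map Subtype.val ≠ some (.atom A)}
  rel R x y := falsifierRel R (x.1.map Subtype.val) (y.1.map Subtype.val) y.2

instance (S : Finset Concept) (K : ℕ) (hK : 0 < K) : Finite (falsifier S K hK).Δ :=
  inferInstanceAs (Finite (Option S × Fin K))

theorem card_falsifier (S : Finset Concept) (K : ℕ) (hK : 0 < K) :
    Nat.card (falsifier S K hK).Δ = (S.card + 1) * K := by
  change Nat.card (Option S × Fin K) = _
  simp

theorem IsELQ.notMem_sem_falsifier {SC SR : Finset ℕ} {C : Concept} (h : IsELQ SC SR C)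
    {S : Finset Concept} {K : ℕ} {hK : 0 < K} {G : S} (hG : G.1 ∈ C.conjuncts) (i : Fin K) :
    ((some G, i) : Option S × Fin K) ∉ C.sem (falsifier S K hK) := by
  induction h generalizing G i with
  | @atom A hA =>
    intro hx
    exact hx (congrArg some (Finset.mem_singleton.mp hG))
  | top => simp [Concept.conjuncts] at hG
  | and _ _ ihC ihD =>
    rintro ⟨hx, hy⟩
    rcases Finset.mem_union.mp hG with hG | hG
    · exact ihC hG i hx
    · exact ihD hG i hy
  | @atLeast k R C hk hR _ ih =>
    rintro ⟨s, hs, hs'⟩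
    have hG' : G.1 = .atLeast k (.name R) C := Finset.mem_singleton.mp hG
    have key : ∀ e ∈ s, (e : Option S × Fin K).1 = none ∧ (e : Option S × Fin K).2.1 + 1 < k := by
      rintro ⟨y, j⟩ he
      obtain ⟨hr, hC⟩ := hs' _ he
      have hr' := hr k C (congrArg some hG')
      cases y with
      | none => exact ⟨rfl, hr'⟩
      | some y => exact absurd hC (ih hr' j)
    have hle : s.card ≤ (Finset.range (k - 1)).card := by
      refine Finset.card_le_card_of_injOn (fun e : Option S × Fin K => e.2.1) ?_ ?_
      · intro e he
        have := (key e he).2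
        simp only [Finset.coe_range, Set.mem_Iio]
        omega
      · intro e he e' he' hee
        exact Prod.ext ((key e he).1.trans (key e' he').1.symm) (Fin.ext hee)
    rw [Finset.card_range] at hle
    omega

/-- The first `l` copies of an element of the falsifying interpretation witness `≥ l`. -/
theorem mem_sem_falsifier_atLeast {S : Finset Concept} {K : ℕ} {hK : 0 < K} {l R : ℕ}
    {E : Concept} {x : (falsifier S K hK).Δ} (y : Option S) (hl : l ≤ K)
    (hE : ∀ j : Fin K, ((y, j) : Option S × Fin K) ∈ E.sem (falsifier S K hK))
    (hr : ∀ j : Fin K, j.1 < l → (falsifier S K hK).rel R x (y, j)) :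
    x ∈ (Concept.atLeast l (.name R) E).sem (falsifier S K hK) := by
  let φ : Fin l ↪ Option S × Fin K :=
    ⟨fun j => (y, Fin.castLE hl j), fun a b hab => by simpa using hab⟩
  refine ⟨Finset.univ.map φ, (Finset.card_map φ).trans (Finset.card_fin l), ?_⟩
  intro e he
  obtain ⟨j, -, rfl⟩ := Finset.mem_map.mp he
  exact ⟨hr _ j.2, hE _⟩

theorem IsELQ.mem_sem_falsifier_none {SC SR : Finset ℕ} {D : Concept} (h : IsELQ SC SR D)
    {S : Finset Concept} {K : ℕ} {hK : 0 < K} (hD : D.nr ≤ K) (i : Fin K) :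
    ((none, i) : Option S × Fin K) ∈ D.sem (falsifier S K hK) := by
  induction h generalizing i with
  | atom hA => exact fun hx => Option.some_ne_none _ hx.symm
  | top => trivial
  | and _ _ ihC ihD =>
    exact ⟨ihC ((le_max_left _ _).trans hD) i, ihD ((le_max_right _ _).trans hD) i⟩
  | atLeast hk hR _ ih =>
    refine mem_sem_falsifier_atLeast none ((le_max_left _ _).trans hD)
      (fun j => ih ((le_max_right _ _).trans hD) j) ?_
    intro j hj k F hx
    exact absurd hx.symm (Option.some_ne_none _)

/-- A concept with small numbers that fails at all falsifiers of `C` is subsumed by `C`. -/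
theorem IsELQ.subsumes_of_falsifier {SC SR : Finset ℕ} {C : Concept} (hC : IsELQ SC SR C)
    {S : Finset Concept} (hS : C.nestedConjuncts ⊆ S) {K : ℕ} {hK : 0 < K} {E : Concept}
    (hE : IsELQ SC SR E) (hEK : E.nr ≤ K)
    (hneg : ∀ G : S, G.1 ∈ C.conjuncts →
      ∃ i : Fin K, ((some G, i) : Option S × Fin K) ∉ E.sem (falsifier S K hK)) :
    Subsumes E C := by
  induction hC generalizing E with
  | @atom A hA =>
    have hAS : .atom A ∈ S := hS (by simp [Concept.nestedConjuncts])
    obtain ⟨i, hi⟩ := hneg ⟨_, hAS⟩ (by simp [Concept.conjuncts])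
    clear hneg
    induction hE with
    | @atom B hB =>
      by_cases hAB : B = A
      · subst hAB
        exact fun I => subset_rfl
      · refine absurd (fun hx => hAB ?_) hi
        simpa using (Option.some.inj hx).symm
    | top => exact absurd trivial hi
    | @and E₁ E₂ _ _ ih₁ ih₂ =>
      by_cases h₁ : ((some ⟨_, hAS⟩, i) : Option S × Fin K) ∈ E₁.sem (falsifier S K hK)
      · exact fun I => Set.inter_subset_right.trans
          (ih₂ ((le_max_right _ _).trans hEK) (fun h₂ => hi ⟨h₁, h₂⟩) I)
      · exact fun I => Set.inter_subset_left.trans (ih₁ ((le_max_left _ _).trans hEK) h₁ I)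
    | atLeast _ _ hE' _ =>
      refine absurd (mem_sem_falsifier_atLeast none ((le_max_left _ _).trans hEK)
        (fun j => hE'.mem_sem_falsifier_none ((le_max_right _ _).trans hEK) j) ?_) hi
      intro j hj k F hx
      simp at hx
  | top => exact fun I _ _ => trivial
  | and _ _ ih₁ ih₂ =>
    have hS' := Finset.union_subset_iff.mp hS
    intro I
    exact Set.subset_inter
      (ih₁ hS'.1 hE hEK (fun G hG => hneg G (Finset.mem_union_left _ hG)) I)
      (ih₂ hS'.2 hE hEK (fun G hG => hneg G (Finset.mem_union_right _ hG)) I)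
  | @atLeast k R F hk hR hF ih =>
    have hCS : .atLeast k (.name R) F ∈ S := hS (by simp [Concept.nestedConjuncts])
    have hFS : F.nestedConjuncts ⊆ S := (Finset.subset_insert _ _).trans hS
    obtain ⟨i, hi⟩ := hneg ⟨_, hCS⟩ (by simp [Concept.conjuncts])
    clear hneg
    induction hE with
    | atom hB => exact absurd (fun hx => by simp at hx) hi
    | top => exact absurd trivial hi
    | @and E₁ E₂ _ _ ih₁ ih₂ =>
      by_cases h₁ : ((some ⟨_, hCS⟩, i) : Option S × Fin K) ∈ E₁.sem (falsifier S K hK)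
      · exact fun I => Set.inter_subset_right.trans
          (ih₂ ((le_max_right _ _).trans hEK) (fun h₂ => hi ⟨h₁, h₂⟩) I)
      · exact fun I => Set.inter_subset_left.trans (ih₁ ((le_max_left _ _).trans hEK) h₁ I)
    | @atLeast l T E' hl hT hE' _ =>
      have hlK : l ≤ K := (le_max_left _ _).trans hEK
      have hEK' : E'.nr ≤ K := (le_max_right _ _).trans hEK
      have hsat := fun j => hE'.mem_sem_falsifier_none (S := S) (hK := hK) hEK' j
      by_cases hTR : T = R
      · subst hTR
        have hkl : k ≤ l := by
          by_contra! hlt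
          refine hi (mem_sem_falsifier_atLeast none hlK hsat ?_)
          intro j hj k' F' hx
          simp only [Option.map_some, Option.some.injEq, Concept.atLeast.injEq] at hx
          change j.1 + 1 < k'
          omega
        have hsub : Subsumes E' F := by
          refine ih hFS hE' hEK' ?_
          intro G hG
          by_contra! hall
          refine hi (mem_sem_falsifier_atLeast (some G) hlK hall ?_)
          intro j hj k' F' hx
          simp only [Option.map_some, Option.some.injEq, Concept.atLeast.injEq] at hx
          obtain ⟨-, -, rfl⟩ := hx
          exact hG
        rintro I d ⟨s, hs, hs'⟩
        obtain ⟨t, hts, ht⟩ := Finset.exists_subset_card_eq (hkl.trans hs.ge)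
        exact ⟨t, ht, fun e he => ⟨(hs' e (hts he)).1, hsub I (hs' e (hts he)).2⟩⟩
      · refine absurd (mem_sem_falsifier_atLeast none hlK hsat ?_) hi
        intro j hj k' F' hx
        simp only [Option.map_some, Option.some.injEq, Concept.atLeast.injEq,
          Role.name.injEq] at hx
        exact absurd hx.2.1.symm hTR

/-- **Theorem**: `L(≥,⊓,⊤)` admits finite characterisations of doubly
exponential size: every `C ∈ L(≥,⊓,⊤)[SC,SR]` has a finite characterisation
in which each example has domain size at most `N^N`, where
`N = 5·(dp(C)+1)·|C|³ + |C|`, and with at most `N` negative examples. -/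
theorem ELQ_doubly_exponential_characterisations (SC SR : Finset ℕ)
    (C : Concept) (hC : C.inLang ELQops SC SR) :
    ∃ Epos Eneg : List PInterp,
      FinChar (Concept.inLang ELQops SC SR) C Epos Eneg ∧
      (∀ e ∈ Epos ++ Eneg,
        Nat.card e.I.Δ ≤
          (5 * (C.dp + 1) * C.size ^ 3 + C.size) ^ (5 * (C.dp + 1) * C.size ^ 3 + C.size)) ∧
      Eneg.length ≤ 5 * (C.dp + 1) * C.size ^ 3 + C.size := by
  have hC' := IsELQ.of_inLang hC
  set N := 5 * (C.dp + 1) * C.size ^ 3 + C.size with hN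
  have hsize := C.one_le_size
  have hsizeN : C.size + 1 ≤ N := by
    have : 1 ≤ 5 * (C.dp + 1) * C.size ^ 3 := Nat.one_le_iff_ne_zero.mpr (by positivity)
    omega
  have hpow : (C.size + 1) * 2 ^ C.size ≤ N ^ N :=
    calc (C.size + 1) * 2 ^ C.size ≤ N * N ^ C.size :=
          Nat.mul_le_mul hsizeN (Nat.pow_le_pow_left (by omega) _)
      _ = N ^ (C.size + 1) := (pow_succ' _ _).symm
      _ ≤ N ^ N := Nat.pow_le_pow_right (by omega) hsizeN
  have hK : 0 < 2 ^ C.size := by positivity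
  let J := falsifier C.nestedConjuncts (2 ^ C.size) hK
  obtain ⟨Epos, hpos, hmem⟩ := exists_list_small_models SC SR C (2 ^ C.size)
  let point (G : C.conjuncts) : J.Δ := (some ⟨G.1, C.conjuncts_subset G.2⟩, ⟨0, hK⟩)
  let Eneg : List PInterp := C.conjuncts.attach.toList.map fun G => ⟨J, point G⟩
  have hEneg : ∀ e, e ∈ Eneg ↔ ∃ G, (⟨J, point G⟩ : PInterp) = e := by simp [Eneg]
  have hJ : Nat.card J.Δ ≤ N ^ N := by
    refine le_trans ?_ hpow
    rw [card_falsifier]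
    exact Nat.mul_le_mul_right _ (Nat.succ_le_succ C.card_nestedConjuncts_le)
  refine ⟨Epos, Eneg, ⟨?_, ⟨fun e he => (hpos e he).2.2, ?_⟩, ?_⟩, ?_, ?_⟩
  · intro e he
    rcases List.mem_append.mp he with he | he
    · exact (hpos e he).1
    · obtain ⟨G, rfl⟩ := (hEneg e).mp he
      exact inferInstanceAs (Finite (falsifier C.nestedConjuncts (2 ^ C.size) hK).Δ)
  · intro e he
    obtain ⟨G, rfl⟩ := (hEneg e).mp he
    exact hC'.notMem_sem_falsifier (hK := hK)
      (G := ⟨G.1, C.conjuncts_subset G.2⟩) G.2 _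
  · rintro D hD ⟨hDpos, hDneg⟩
    have hD' := IsELQ.of_inLang hD
    have hDK : D.nr ≤ 2 ^ C.size := by
      obtain ⟨m, p, g, hm, -, -, hp⟩ := hC'.exists_small_pullback J
        (hC'.mem_sem_falsifier_none hC'.nr_le_two_pow_size ⟨0, hK⟩)
      have he := hmem m p _ _ hm hp
      have : Finite (J.pullback SC SR p g).Δ := (hpos _ he).1
      exact (hD'.nr_le_card (J.pullback SC SR p g) (hDpos _ he)).trans (hpos _ he).2.1
    refine fun I => Set.Subset.antisymm ?_ ?_
    · intro d hd
      obtain ⟨m, p, g, hm, hg, rfl, hp⟩ := hC'.exists_small_pullback I hd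
      exact hD'.sem_of_sem_pullback I p hg (hDpos _ (hmem m p _ _ hm hp))
    · exact hC'.subsumes_of_falsifier (hK := hK) subset_rfl hD' hDK
        (fun G hG => ⟨⟨0, hK⟩, hDneg _ ((hEneg _).mpr ⟨⟨G.1, hG⟩, rfl⟩)⟩) I
  · intro e he
    rcases List.mem_append.mp he with he | he
    · exact (hpos e he).2.1.trans (le_trans (Nat.le_mul_of_pos_left _ (by omega)) hpow)
    · obtain ⟨G, rfl⟩ := (hEneg e).mp he
      exact hJ
  · have h₁ := Finset.card_le_card C.conjuncts_subset
    have h₂ := C.card_nestedConjuncts_le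
    simp only [Eneg, List.length_map, Finset.length_toList, Finset.card_attach]
    omega

end DL
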